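/- arXiv:math/9809112 — 5 statements merged into one kernel-verified Lean document; each statement's English description precedes it below -/
import Mathlib

section
/- One has the identity c_0 = (1 − p^{-2})^{-1}·(Φ(δ_0) + p^{-1}·δ_{-1}) of functions on ℚ_p², where c_0 is the indicator function of ℤ_p² ⊆ ℚ_p², δ_0(x) = 1 if x ∈ ℤ_p² ∖ (pℤ_p)² and 0 otherwise, and δ_{-1}(x) = p^{-1} if x ∈ (p^{-1}ℤ_p)² ∖ ℤ_p² and 0 otherwise. In particular the indicator function of ℤ_p² lies in the linear span of compactly supported locally constant functions vanishing near 0 together with their symplectic Fourier transforms. -/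
open MeasureTheory

/-- The symplectic Fourier transform on `ℚ_p²`:
`Φ(f)(y₁,y₂) = ∫ ψ(x₁ y₂ − x₂ y₁) f(x₁,x₂) dμ²(x)`. -/
noncomputable def sympFourier (p : ℕ) [Fact p.Prime] [MeasurableSpace ℚ_[p]]
    (μ : Measure ℚ_[p]) (ψ : AddChar ℚ_[p] ℂ)
    (f : ℚ_[p] × ℚ_[p] → ℂ) : ℚ_[p] × ℚ_[p] → ℂ :=
  fun y => ∫ x : ℚ_[p] × ℚ_[p], ψ (x.1 * y.2 - x.2 * y.1) * f x ∂(μ.prod μ)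

/-- `c_n(x) = p^n` if `x ∈ (p^n ℤ_p)²` (i.e. both coordinates have norm `≤ p^{-n}`),
and `0` otherwise. -/
noncomputable def cFun (p : ℕ) [Fact p.Prime] (n : ℤ) : ℚ_[p] × ℚ_[p] → ℂ :=
  fun x => if ‖x.1‖ ≤ (p : ℝ) ^ (-n) ∧ ‖x.2‖ ≤ (p : ℝ) ^ (-n) then (p : ℂ) ^ n else 0

/-- `δ_n(x) = p^n` if `x ∈ (p^n ℤ_p)² ∖ (p^{n+1} ℤ_p)²`, and `0` otherwise. -/
noncomputable def deltaFun (p : ℕ) [Fact p.Prime] (n : ℤ) : ℚ_[p] × ℚ_[p] → ℂ :=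
  fun x =>
    if (‖x.1‖ ≤ (p : ℝ) ^ (-n) ∧ ‖x.2‖ ≤ (p : ℝ) ^ (-n)) ∧
        ¬(‖x.1‖ ≤ (p : ℝ) ^ (-(n + 1)) ∧ ‖x.2‖ ≤ (p : ℝ) ^ (-(n + 1))) then
      (p : ℂ) ^ n
    else 0

section CharacterIntegrals

variable {p : ℕ} [Fact p.Prime]

theorem Padic.measure_norm_le_inv [MeasurableSpace ℚ_[p]] [BorelSpace ℚ_[p]]
    (μ : Measure ℚ_[p]) [μ.IsAddHaarMeasure] :
    μ {x : ℚ_[p] | ‖x‖ ≤ 1} = p * μ {x : ℚ_[p] | ‖x‖ ≤ (p : ℝ)⁻¹} := by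
  have hp : (1 : ℝ) < p := by exact_mod_cast (Fact.out : p.Prime).one_lt
  have norm_lt_one_iff (x : ℚ_[p]) : ‖x‖ < 1 ↔ ‖x‖ ≤ (p : ℝ)⁻¹ := by
    simpa using Padic.norm_lt_pow_iff_norm_le_pow_sub_one x 0
  have hU : {x : ℚ_[p] | ‖x‖ ≤ 1} = ⋃ n ∈ Finset.range p,
      (fun x : ℚ_[p] => x + -(n : ℚ_[p])) ⁻¹' {x : ℚ_[p] | ‖x‖ ≤ (p : ℝ)⁻¹} := by
    ext x
    simp only [Set.mem_ofPred_eq, Set.mem_iUnion, Set.mem_preimage, Finset.mem_range, exists_prop,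
      ← norm_lt_one_iff]
    constructor
    · intro hx
      obtain ⟨n, hn, h⟩ := PadicInt.exists_mem_range (⟨x, hx⟩ : ℤ_[p])
      refine ⟨n, hn, ?_⟩
      rw [IsLocalRing.mem_maximalIdeal, PadicInt.mem_nonunits] at h
      rwa [← sub_eq_add_neg]
    · rintro ⟨n, -, h⟩
      have hn : ‖(n : ℚ_[p])‖ ≤ 1 := by simpa using Padic.norm_int_le_one (p := p) (n : ℤ)
      have := Padic.nonarchimedean (x + -(n : ℚ_[p])) n
      rw [neg_add_cancel_right] at this
      exact this.trans (max_le h.le hn)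
  have hmeas : MeasurableSet {x : ℚ_[p] | ‖x‖ ≤ (p : ℝ)⁻¹} :=
    measurableSet_le measurable_norm measurable_const
  rw [hU, measure_biUnion_finset]
  · simp only [measure_preimage_add_right, Finset.sum_const, Finset.card_range, nsmul_eq_mul]
  · intro m hm n hn hmn
    rw [Function.onFun, Set.disjoint_left]
    intro x hx hx'
    simp only [Set.mem_ofPred_eq, Set.mem_preimage, ← norm_lt_one_iff] at hx hx'
    have h : ‖((n - m : ℤ) : ℚ_[p])‖ < 1 := by
      have h1 := Padic.nonarchimedean (x + -(m : ℚ_[p])) (-(x + -(n : ℚ_[p])))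
      rw [norm_neg] at h1
      have h2 : x + -(m : ℚ_[p]) + -(x + -(n : ℚ_[p])) = ((n - m : ℤ) : ℚ_[p]) := by
        push_cast; ring
      rw [h2] at h1
      exact h1.trans_lt (max_lt hx hx')
    rw [Padic.norm_intCast_lt_one_iff] at h
    simp only [Finset.coe_range, Set.mem_Iio] at hm hn
    exact hmn ((Nat.modEq_iff_dvd.2 h).eq_of_lt_of_lt hm hn)
  · intro n _
    exact hmeas.preimage (measurable_id.add_const _)

/-- The integrand of the Fourier transform at `y` of the indicator function of the ball of
radius `r`. -/
noncomputable def AddChar.ballIntegrand (ψ : AddChar ℚ_[p] ℂ) (r : ℝ) (y x : ℚ_[p]) : ℂ :=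
  ψ (x * y) * if ‖x‖ ≤ r then 1 else 0

theorem AddChar.ballIntegrand_eq_indicator (ψ : AddChar ℚ_[p] ℂ) (r : ℝ) (y : ℚ_[p]) :
    ψ.ballIntegrand r y = {x : ℚ_[p] | ‖x‖ ≤ r}.indicator fun x => ψ (x * y) := by
  ext x
  simp [AddChar.ballIntegrand, Set.indicator_apply]

variable [MeasurableSpace ℚ_[p]] [BorelSpace ℚ_[p]] (μ : Measure ℚ_[p])

theorem AddChar.integral_ballIntegrand_of_trivial (ψ : AddChar ℚ_[p] ℂ) {r : ℝ} {y : ℚ_[p]}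
    (h : ∀ x : ℚ_[p], ‖x‖ ≤ r → ψ (x * y) = 1) :
    ∫ x, ψ.ballIntegrand r y x ∂μ = μ.real {x : ℚ_[p] | ‖x‖ ≤ r} := by
  have hmeas : MeasurableSet {x : ℚ_[p] | ‖x‖ ≤ r} :=
    measurableSet_le measurable_norm measurable_const
  rw [AddChar.ballIntegrand_eq_indicator, integral_indicator hmeas,
    setIntegral_congr_fun (g := fun _ => 1) hmeas h]
  simp

variable [μ.IsAddHaarMeasure]

theorem AddChar.integrable_ballIntegrand {ψ : AddChar ℚ_[p] ℂ} (hψ : Continuous ψ)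
    (r : ℝ) (y : ℚ_[p]) : Integrable (ψ.ballIntegrand r y) μ := by
  rw [AddChar.ballIntegrand_eq_indicator,
    integrable_indicator_iff (measurableSet_le measurable_norm measurable_const)]
  refine ContinuousOn.integrableOn_compact ?_ (by fun_prop)
  simpa [Metric.closedBall, dist_zero_right] using isCompact_closedBall (0 : ℚ_[p]) r

theorem AddChar.integral_ballIntegrand_of_nontrivial (ψ : AddChar ℚ_[p] ℂ) {r : ℝ}
    {y a : ℚ_[p]} (ha : ‖a‖ ≤ r) (h : ψ (a * y) ≠ 1) :
    ∫ x, ψ.ballIntegrand r y x ∂μ = 0 := by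
  have key (x : ℚ_[p]) : ψ.ballIntegrand r y (x + a) = ψ (a * y) * ψ.ballIntegrand r y x := by
    have hiff : ‖x + a‖ ≤ r ↔ ‖x‖ ≤ r := by
      refine ⟨fun hx => ?_, fun hx => (Padic.nonarchimedean x a).trans (max_le hx ha)⟩
      have := Padic.nonarchimedean (x + a) (-a)
      rw [add_neg_cancel_right, norm_neg] at this
      exact this.trans (max_le hx ha)
    simp only [AddChar.ballIntegrand, hiff, add_mul, AddChar.map_add_eq_mul]
    ring
  have h1 := integral_add_right_eq_self (μ := μ) (ψ.ballIntegrand r y) a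
  simp only [key] at h1
  rw [integral_const_mul] at h1
  by_contra h0
  exact h (mul_right_cancel₀ h0 (h1.trans (one_mul _).symm))

theorem AddChar.integral_ballIntegrand {ψ : AddChar ℚ_[p] ℂ}
    (hψtriv : ∀ x : ℚ_[p], ‖x‖ ≤ 1 → ψ x = 1)
    (hψnontriv : ∃ x : ℚ_[p], ‖x‖ ≤ (p : ℝ) ∧ ψ x ≠ 1) (k : ℤ) (y : ℚ_[p]) :
    ∫ x, ψ.ballIntegrand ((p : ℝ) ^ (-k)) y x ∂μ =
      if ‖y‖ ≤ (p : ℝ) ^ k then (μ.real {x : ℚ_[p] | ‖x‖ ≤ (p : ℝ) ^ (-k)} : ℂ) else 0 := by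
  have hp : (0 : ℝ) < p := by exact_mod_cast (Fact.out : p.Prime).pos
  split_ifs with hy
  · refine ψ.integral_ballIntegrand_of_trivial μ fun x hx => hψtriv _ ?_
    calc ‖x * y‖ = ‖x‖ * ‖y‖ := norm_mul _ _
      _ ≤ (p : ℝ) ^ (-k) * (p : ℝ) ^ k := by gcongr
      _ = 1 := by rw [← zpow_add₀ hp.ne', neg_add_cancel, zpow_zero]
  · obtain ⟨b, hb, hψb⟩ := hψnontriv
    have hy0 : y ≠ 0 := by
      rintro rfl
      exact hy (by simpa using (zpow_pos hp k).le)
    have hy' : (p : ℝ) ^ (k + 1) ≤ ‖y‖ := by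
      rwa [Padic.norm_le_pow_iff_norm_lt_pow_add_one, not_lt] at hy
    refine ψ.integral_ballIntegrand_of_nontrivial μ (a := b / y) ?_
      (by rwa [div_mul_cancel₀ _ hy0])
    rw [norm_div, div_le_iff₀ (norm_pos_iff.2 hy0)]
    calc ‖b‖ ≤ p := hb
      _ = (p : ℝ) ^ (-k) * (p : ℝ) ^ (k + 1) := by
        rw [← zpow_add₀ hp.ne', neg_add_cancel_left, zpow_one]
      _ ≤ _ := by gcongr

/-- The symplectic Fourier transform of `δ_0` as a difference of products of one-dimensional
integrals. -/
theorem sympFourier_deltaFun_zero {ψ : AddChar ℚ_[p] ℂ} (hψ : Continuous ψ)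
    (y : ℚ_[p] × ℚ_[p]) :
    sympFourier p μ ψ (deltaFun p 0) y =
      (∫ x, ψ.ballIntegrand ((p : ℝ) ^ (-0 : ℤ)) y.2 x ∂μ) *
          (∫ x, ψ.ballIntegrand ((p : ℝ) ^ (-0 : ℤ)) (-y.1) x ∂μ) -
        (∫ x, ψ.ballIntegrand ((p : ℝ) ^ (-1 : ℤ)) y.2 x ∂μ) *
          (∫ x, ψ.ballIntegrand ((p : ℝ) ^ (-1 : ℤ)) (-y.1) x ∂μ) := by
  have hp : (1 : ℝ) ≤ p := by exact_mod_cast (Fact.out : p.Prime).one_le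
  have hle : (p : ℝ) ^ (-1 : ℤ) ≤ (p : ℝ) ^ (-0 : ℤ) := zpow_le_zpow_right₀ hp (by norm_num)
  rw [← integral_prod_mul, ← integral_prod_mul, ← integral_sub]
  · refine integral_congr_ae (.of_forall fun x => ?_)
    have hadd : ψ (x.1 * y.2 - x.2 * y.1) = ψ (x.1 * y.2) * ψ (x.2 * -y.1) := by
      rw [← AddChar.map_add_eq_mul, mul_neg, sub_eq_add_neg]
    have h1 : ‖x.1‖ ≤ (p : ℝ) ^ (-1 : ℤ) → ‖x.1‖ ≤ (p : ℝ) ^ (-0 : ℤ) := fun h => h.trans hle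
    have h2 : ‖x.2‖ ≤ (p : ℝ) ^ (-1 : ℤ) → ‖x.2‖ ≤ (p : ℝ) ^ (-0 : ℤ) := fun h => h.trans hle
    simp only [hadd, deltaFun, AddChar.ballIntegrand, zero_add, zpow_zero]
    by_cases a1 : ‖x.1‖ ≤ (p : ℝ) ^ (-1 : ℤ) <;> by_cases a2 : ‖x.2‖ ≤ (p : ℝ) ^ (-1 : ℤ) <;>
      by_cases b1 : ‖x.1‖ ≤ (p : ℝ) ^ (-0 : ℤ) <;> by_cases b2 : ‖x.2‖ ≤ (p : ℝ) ^ (-0 : ℤ) <;>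
      first
      | exact absurd (h1 a1) b1
      | exact absurd (h2 a2) b2
      | simp only [a1, a2, b1, b2]; simp
  · exact (AddChar.integrable_ballIntegrand μ hψ _ _).mul_prod
      (AddChar.integrable_ballIntegrand μ hψ _ _)
  · exact (AddChar.integrable_ballIntegrand μ hψ _ _).mul_prod
      (AddChar.integrable_ballIntegrand μ hψ _ _)

end CharacterIntegrals

/-- `c_0 = (1 − p^{-2})⁻¹ · (Φ(δ_0) + p⁻¹ · δ_{-1})` as functions on `ℚ_p²`. -/
theorem cFun_zero_eq (p : ℕ) [Fact p.Prime]
    [MeasurableSpace ℚ_[p]] [BorelSpace ℚ_[p]]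
    (μ : Measure ℚ_[p]) [μ.IsAddHaarMeasure]
    (hμ : μ {x : ℚ_[p] | ‖x‖ ≤ 1} = 1)
    (ψ : AddChar ℚ_[p] ℂ) (hψcont : Continuous ψ)
    (hψnorm : ∀ x : ℚ_[p], ‖ψ x‖ = 1)
    (hψtriv : ∀ x : ℚ_[p], ‖x‖ ≤ 1 → ψ x = 1)
    (hψnontriv : ∃ x : ℚ_[p], ‖x‖ ≤ (p : ℝ) ∧ ψ x ≠ 1) :
    cFun p 0 =
      (1 - (p : ℂ) ^ (-2 : ℤ))⁻¹ •
        (sympFourier p μ ψ (deltaFun p 0) + (p : ℂ)⁻¹ • deltaFun p (-1)) := by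
  have hp : (1 : ℝ) < p := by exact_mod_cast (Fact.out : p.Prime).one_lt
  have hpC : (p : ℂ) ≠ 0 := by exact_mod_cast (Fact.out : p.Prime).ne_zero
  have hp2 : (p : ℂ) ^ 2 - 1 ≠ 0 := by
    have h : (p : ℝ) ^ 2 - 1 ≠ 0 := by nlinarith
    exact_mod_cast h
  have hμ1 : μ.real {x : ℚ_[p] | ‖x‖ ≤ (p : ℝ) ^ (-0 : ℤ)} = 1 := by
    simp [measureReal_def, hμ]
  have hμp : μ.real {x : ℚ_[p] | ‖x‖ ≤ (p : ℝ) ^ (-1 : ℤ)} = (p : ℝ)⁻¹ := by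
    have h := congrArg ENNReal.toReal (Padic.measure_norm_le_inv μ)
    rw [hμ, ENNReal.toReal_mul] at h
    rw [measureReal_def, zpow_neg_one]
    refine eq_inv_of_mul_eq_one_right ?_
    simpa using h.symm
  ext y
  simp only [Pi.smul_apply, Pi.add_apply, smul_eq_mul, sympFourier_deltaFun_zero μ hψcont,
    AddChar.integral_ballIntegrand μ hψtriv hψnontriv, hμ1, hμp, norm_neg]
  have h1 : ‖y.1‖ ≤ 1 → ‖y.1‖ ≤ p := fun h => h.trans hp.le
  have h2 : ‖y.2‖ ≤ 1 → ‖y.2‖ ≤ p := fun h => h.trans hp.le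
  simp only [cFun, deltaFun, neg_zero, neg_neg, neg_add_cancel, zpow_neg, zpow_ofNat]
  by_cases a1 : ‖y.1‖ ≤ 1 <;> by_cases a2 : ‖y.2‖ ≤ 1 <;>
    by_cases b1 : ‖y.1‖ ≤ p <;> by_cases b2 : ‖y.2‖ ≤ p <;>
    first
    | exact absurd (h1 a1) b1
    | exact absurd (h2 a2) b2
    | simp [a1, a2, b1, b2] <;> field_simp
end

section
/- For every locally constant compactly supported function f : ℚ_p² → ℂ there exist locally constant compactly supported functions g, h : ℚ_p² → ℂ, each vanishing on some neighborhood of the origin (0,0), such that f = g + Φ(h). (This is the description of the Schwartz space of the basic affine space of SL(2): S(X) = C_c^∞(ℚ_p²), where X = ℚ_p² ∖ {0}.) -/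
open MeasureTheory

/-- The symplectic Fourier transform vanishes at `y` as soon as `f` is invariant under a translation
on which the character attached to `y` is nontrivial. -/
lemma sympFourier_eq_zero_of_translation (p : ℕ) [Fact p.Prime]
    [MeasurableSpace ℚ_[p]] [BorelSpace ℚ_[p]] (μ : Measure ℚ_[p]) [μ.IsAddHaarMeasure]
    (ψ : AddChar ℚ_[p] ℂ) (f : ℚ_[p] × ℚ_[p] → ℂ) (y t : ℚ_[p] × ℚ_[p])
    (hft : ∀ x, f (t + x) = f x) (ht : ψ (t.1 * y.2 - t.2 * y.1) ≠ 1) :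
    sympFourier p μ ψ f y = 0 := by
  have key : sympFourier p μ ψ f y =
      ψ (t.1 * y.2 - t.2 * y.1) * sympFourier p μ ψ f y := by
    unfold sympFourier
    rw [← integral_const_mul]
    conv_lhs => rw [← integral_add_left_eq_self _ t]
    refine integral_congr_ae (Filter.Eventually.of_forall fun x => ?_)
    simp only [hft, Prod.fst_add, Prod.snd_add]
    rw [← mul_assoc, ← AddChar.map_add_eq_mul]
    congr 2
    ring
  have h2 : (ψ (t.1 * y.2 - t.2 * y.1) - 1) * sympFourier p μ ψ f y = 0 := by
    linear_combination -key
  exact (mul_eq_zero.mp h2).resolve_left (sub_ne_zero.mpr ht)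

/-- Every `x` with `‖x‖ ≤ p` is an integral multiple of any given point outside the unit ball. -/
lemma exists_norm_le_one_mul_eq (p : ℕ) [Fact p.Prime] {x z : ℚ_[p]} (hx : ‖x‖ ≤ p)
    (hz : 1 < ‖z‖) : ∃ s : ℚ_[p], ‖s‖ ≤ 1 ∧ s * z = x := by
  have hz0 : z ≠ 0 := norm_pos_iff.mp (one_pos.trans hz)
  refine ⟨x / z, ?_, div_mul_cancel₀ _ hz0⟩
  have hp : (1 : ℝ) < p := by exact_mod_cast (Fact.out : p.Prime).one_lt
  rw [norm_div, div_le_one (one_pos.trans hz)]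
  rw [Padic.norm_eq_zpow_neg_valuation hz0] at hz ⊢
  have : 0 < -z.valuation := (one_lt_zpow_iff_right₀ hp).mp hz
  calc ‖x‖ ≤ (p : ℝ) ^ (1 : ℤ) := by simpa using hx
    _ ≤ _ := zpow_le_zpow_right₀ hp.le (by omega)

/-- The symplectic Fourier transform of a multiple of the indicator function of
`(u + ℤ_p) × ℤ_p`. -/
lemma sympFourier_indicator_closedBall (p : ℕ) [Fact p.Prime]
    [MeasurableSpace ℚ_[p]] [BorelSpace ℚ_[p]]
    (μ : Measure ℚ_[p]) [μ.IsAddHaarMeasure]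
    (hμ : μ {x : ℚ_[p] | ‖x‖ ≤ 1} = 1) (ψ : AddChar ℚ_[p] ℂ)
    (hψtriv : ∀ x : ℚ_[p], ‖x‖ ≤ 1 → ψ x = 1)
    (hψnontriv : ∃ x : ℚ_[p], ‖x‖ ≤ (p : ℝ) ∧ ψ x ≠ 1) (u : ℚ_[p]) (c : ℂ) :
    sympFourier p μ ψ ((Metric.closedBall u 1 ×ˢ Metric.closedBall 0 1).indicator fun _ => c) =
      (Metric.closedBall 0 1 ×ˢ Metric.closedBall 0 1).indicator fun y => ψ (u * y.2) * c := by
  classical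
  have hball : ∀ s w : ℚ_[p], ‖s‖ ≤ 1 → ∀ a : ℚ_[p],
      (s + w ∈ Metric.closedBall a 1 ↔ w ∈ Metric.closedBall a 1) := by
    intro s w hs a
    simp only [mem_closedBall_iff_norm]
    constructor <;> intro h
    · have := Padic.nonarchimedean (-s) (s + w - a)
      rw [norm_neg, show -s + (s + w - a) = w - a by ring] at this
      exact this.trans (max_le hs h)
    · rw [add_sub_assoc]
      exact (Padic.nonarchimedean _ _).trans (max_le hs h)
  have hinv : ∀ t : ℚ_[p] × ℚ_[p], ‖t.1‖ ≤ 1 → ‖t.2‖ ≤ 1 → ∀ x,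
      ((Metric.closedBall u 1 ×ˢ Metric.closedBall 0 1).indicator fun _ => c) (t + x) =
      ((Metric.closedBall u 1 ×ˢ Metric.closedBall (0 : ℚ_[p]) 1).indicator fun _ => c) x := by
    intro t h1 h2 x
    simp only [Set.indicator_apply, Set.mem_prod, Prod.fst_add, Prod.snd_add,
      hball _ _ h1, hball _ _ h2]
  obtain ⟨x₀, hx₀, hψx₀⟩ := hψnontriv
  ext y
  by_cases hy : y ∈ Metric.closedBall (0 : ℚ_[p]) 1 ×ˢ Metric.closedBall (0 : ℚ_[p]) 1
  · rw [Set.indicator_of_mem hy]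
    simp only [Set.mem_prod, mem_closedBall_zero_iff] at hy
    have hint : ∀ x : ℚ_[p] × ℚ_[p], ψ (x.1 * y.2 - x.2 * y.1) *
        ((Metric.closedBall u 1 ×ˢ Metric.closedBall (0 : ℚ_[p]) 1).indicator fun _ => c) x =
        (Metric.closedBall u 1 ×ˢ Metric.closedBall (0 : ℚ_[p]) 1).indicator
          (fun _ => ψ (u * y.2) * c) x := by
      intro x
      by_cases hx : x ∈ Metric.closedBall u 1 ×ˢ Metric.closedBall (0 : ℚ_[p]) 1
      · rw [Set.indicator_of_mem hx, Set.indicator_of_mem hx]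
        simp only [Set.mem_prod, mem_closedBall_iff_norm, sub_zero] at hx
        have h1 : ‖(x.1 - u) * y.2‖ ≤ 1 := by
          rw [norm_mul]; exact mul_le_one₀ hx.1 (norm_nonneg _) hy.2
        have h2 : ‖-(x.2 * y.1)‖ ≤ 1 := by
          rw [norm_neg, norm_mul]; exact mul_le_one₀ hx.2 (norm_nonneg _) hy.1
        rw [show x.1 * y.2 - x.2 * y.1 = u * y.2 + ((x.1 - u) * y.2 + -(x.2 * y.1)) by ring,
          AddChar.map_add_eq_mul, AddChar.map_add_eq_mul, hψtriv _ h1, hψtriv _ h2]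
        ring
      · rw [Set.indicator_of_notMem hx, Set.indicator_of_notMem hx, mul_zero]
    have h0 : μ (Metric.closedBall 0 1) = 1 := by
      rw [← hμ]; congr 1; ext; simp
    have hu : μ (Metric.closedBall u 1) = 1 := by
      rw [← h0, ← measure_preimage_add μ u (Metric.closedBall u 1)]
      congr 1; ext; simp
    unfold sympFourier
    simp only [hint]
    rw [integral_indicator_const _ (measurableSet_closedBall.prod measurableSet_closedBall),
      measureReal_def, Measure.prod_prod, h0, hu]
    simp
  · rw [Set.indicator_of_notMem hy]
    simp only [Set.mem_prod, mem_closedBall_zero_iff, not_and_or, not_le] at hy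
    rcases hy with hy | hy
    · obtain ⟨s, hs, hsy⟩ := exists_norm_le_one_mul_eq p (x := -x₀) (by simpa using hx₀) hy
      refine sympFourier_eq_zero_of_translation p μ ψ _ y (0, s) (hinv _ (by simp) hs) ?_
      simpa [hsy] using hψx₀
    · obtain ⟨s, hs, hsy⟩ := exists_norm_le_one_mul_eq p hx₀ hy
      refine sympFourier_eq_zero_of_translation p μ ψ _ y (s, 0) (hinv _ hs (by simp)) ?_
      simpa [hsy] using hψx₀

/-- The indicator of a locally constant function on a clopen set is locally constant. -/
lemma isLocallyConstant_indicator {X M : Type*} [TopologicalSpace X] [Zero M] {f : X → M}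
    (hf : IsLocallyConstant f) {s : Set X} (hs : IsClopen s) :
    IsLocallyConstant (s.indicator f) := by
  rw [IsLocallyConstant.iff_eventually_eq]
  intro x
  by_cases hx : x ∈ s
  · filter_upwards [hf.eventually_eq x, hs.isOpen.mem_nhds hx] with y hy hys
    rw [Set.indicator_of_mem hys, Set.indicator_of_mem hx, hy]
  · filter_upwards [hs.compl.isOpen.mem_nhds hx] with y hy
    rw [Set.indicator_of_notMem hy, Set.indicator_of_notMem hx]

/-- An additive character that is trivial on the unit ball is locally constant. -/
lemma AddChar.isLocallyConstant_of_trivial_on_unitBall (p : ℕ) [Fact p.Prime]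
    (ψ : AddChar ℚ_[p] ℂ) (hψtriv : ∀ x : ℚ_[p], ‖x‖ ≤ 1 → ψ x = 1) :
    IsLocallyConstant ψ := by
  rw [IsLocallyConstant.iff_eventually_eq]
  intro x
  filter_upwards [Metric.closedBall_mem_nhds x one_pos] with y hy
  rw [← sub_add_cancel y x, AddChar.map_add_eq_mul,
    hψtriv _ (mem_closedBall_iff_norm.mp hy), one_mul]

/-- every locally constant compactly supported `f : ℚ_p² → ℂ` can be written
as `f = g + Φ(h)` where `g, h` are locally constant, compactly supported, and each vanishes
on a neighborhood of the origin. -/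
theorem schwartz_space_decomposition (p : ℕ) [Fact p.Prime]
    [MeasurableSpace ℚ_[p]] [BorelSpace ℚ_[p]]
    (μ : Measure ℚ_[p]) [μ.IsAddHaarMeasure]
    (hμ : μ {x : ℚ_[p] | ‖x‖ ≤ 1} = 1)
    (ψ : AddChar ℚ_[p] ℂ) (hψcont : Continuous ψ)
    (hψnorm : ∀ x : ℚ_[p], ‖ψ x‖ = 1)
    (hψtriv : ∀ x : ℚ_[p], ‖x‖ ≤ 1 → ψ x = 1)
    (hψnontriv : ∃ x : ℚ_[p], ‖x‖ ≤ (p : ℝ) ∧ ψ x ≠ 1)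
    (f : ℚ_[p] × ℚ_[p] → ℂ) (hf₁ : IsLocallyConstant f) (hf₂ : HasCompactSupport f) :
    ∃ g h : ℚ_[p] × ℚ_[p] → ℂ,
      IsLocallyConstant g ∧ HasCompactSupport g ∧ (∀ᶠ x in nhds (0 : ℚ_[p] × ℚ_[p]), g x = 0) ∧
      IsLocallyConstant h ∧ HasCompactSupport h ∧ (∀ᶠ x in nhds (0 : ℚ_[p] × ℚ_[p]), h x = 0) ∧
      f = g + sympFourier p μ ψ h := by
  set S : Set (ℚ_[p] × ℚ_[p]) :=
    Metric.closedBall ((p : ℚ_[p])⁻¹) 1 ×ˢ Metric.closedBall 0 1 with hS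
  set L : Set (ℚ_[p] × ℚ_[p]) := Metric.closedBall 0 1 ×ˢ Metric.closedBall 0 1 with hL
  have hclopen (a : ℚ_[p]) : IsClopen (Metric.closedBall a 1) :=
    IsUltrametricDist.isClopen_closedBall a one_ne_zero
  have hSclopen : IsClopen S := (hclopen _).prod (hclopen _)
  have hLclopen : IsClopen L := (hclopen _).prod (hclopen _)
  have hScpt : IsCompact S := (isCompact_closedBall _ _).prod (isCompact_closedBall _ _)
  have hLcpt : IsCompact L := (isCompact_closedBall _ _).prod (isCompact_closedBall _ _)
  have h0S : (0 : ℚ_[p] × ℚ_[p]) ∉ S := by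
    simp [hS, (Fact.out : p.Prime).one_lt]
  have h0L : (0 : ℚ_[p] × ℚ_[p]) ∈ L := by simp [hL]
  set k : ℚ_[p] × ℚ_[p] → ℂ := L.indicator fun y => ψ ((p : ℚ_[p])⁻¹ * y.2) * f 0 with hk
  have hFourier : sympFourier p μ ψ (S.indicator fun _ => f 0) = k :=
    sympFourier_indicator_closedBall p μ hμ ψ hψtriv hψnontriv _ _
  have hklc : IsLocallyConstant k := by
    refine isLocallyConstant_indicator ?_ hLclopen
    exact (((AddChar.isLocallyConstant_of_trivial_on_unitBall p ψ hψtriv).comp_continuous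
      (continuous_const.mul continuous_snd)).comp (· * f 0))
  have hkc : HasCompactSupport k :=
    HasCompactSupport.intro hLcpt fun x hx => Set.indicator_of_notMem hx _
  have hglc : IsLocallyConstant (f - k) := hf₁.sub hklc
  refine ⟨f - k, S.indicator fun _ => f 0, hglc, hf₂.sub hkc, ?_,
    isLocallyConstant_indicator (IsLocallyConstant.const _) hSclopen,
    HasCompactSupport.intro hScpt fun x hx => Set.indicator_of_notMem hx _, ?_, ?_⟩
  · filter_upwards [hglc.eventually_eq 0] with x hx
    rw [hx]
    simp [hk, h0L]
  · filter_upwards [hSclopen.compl.isOpen.mem_nhds h0S] with x hx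
    exact Set.indicator_of_notMem hx _
  · rw [hFourier, sub_add_cancel]
end

section
/- The symplectic Fourier transform is an involution on locally constant compactly supported functions: for every locally constant compactly supported f : ℚ_p² → ℂ one has Φ(Φ(f)) = f. -/
open MeasureTheory

open Metric

section PadicHaar

variable {p : ℕ} [Fact p.Prime]

lemma Padic.measure_closedBall_mul_measure_closedBall_inv [MeasurableSpace ℚ_[p]]
    [BorelSpace ℚ_[p]] (μ : Measure ℚ_[p]) [μ.IsAddHaarMeasure]
    (hμ : μ (closedBall 0 1) = 1) {a : ℚ_[p]} (ha : a ≠ 0) :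
    μ (closedBall 0 ‖a‖) * μ (closedBall 0 ‖a⁻¹‖) = 1 := by
  have key (u : ℚ_[p]ˣ) :
      μ (closedBall 0 ‖(u : ℚ_[p])‖) = distribHaarChar ℚ_[p] u := by
    have h := distribHaarChar_mul μ u (closedBall (0 : ℚ_[p]) 1)
    rw [hμ, mul_one] at h
    rw [h]
    congr 1
    ext x
    rw [Set.mem_smul_set_iff_inv_smul_mem]
    simp only [mem_closedBall_zero_iff, Units.smul_def, smul_eq_mul, norm_mul,
      Units.val_inv_eq_inv_val, norm_inv]
    rw [inv_mul_le_iff₀ (norm_pos_iff.2 u.ne_zero), mul_one]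
  have h₁ := key (Units.mk0 a ha)
  have h₂ := key (Units.mk0 a ha)⁻¹
  rw [Units.val_inv_eq_inv_val, Units.val_mk0] at h₂
  rw [Units.val_mk0] at h₁
  rw [h₁, h₂, ← ENNReal.coe_mul, ← map_mul, mul_inv_cancel, map_one, ENNReal.coe_one]

lemma Padic.exists_norm_le_addChar_mul_ne_one {ψ : AddChar ℚ_[p] ℂ}
    (hψnontriv : ∃ x : ℚ_[p], ‖x‖ ≤ (p : ℝ) ∧ ψ x ≠ 1)
    {a b : ℚ_[p]} (hab : 1 < ‖b * a‖) : ∃ h : ℚ_[p], ‖h‖ ≤ ‖a‖ ∧ ψ (b * h) ≠ 1 := by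
  obtain ⟨x, hx, hx1⟩ := hψnontriv
  have hb : b ≠ 0 := by
    rintro rfl
    simp at hab
    linarith
  have hp : (p : ℝ) ≤ ‖b * a‖ := by
    by_contra! h
    have := (Padic.norm_le_pow_iff_norm_lt_pow_add_one (b * a) 0).2 (by simpa using h)
    rw [zpow_zero] at this
    linarith
  refine ⟨x / b, ?_, by rwa [mul_div_cancel₀ _ hb]⟩
  rw [norm_div, div_le_iff₀ (norm_pos_iff.2 hb), mul_comm, ← norm_mul]
  exact hx.trans hp

lemma Padic.setIntegral_closedBall_addChar_mul [MeasurableSpace ℚ_[p]] [BorelSpace ℚ_[p]]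
    (μ : Measure ℚ_[p]) [μ.IsAddHaarMeasure] {ψ : AddChar ℚ_[p] ℂ}
    (hψtriv : ∀ x : ℚ_[p], ‖x‖ ≤ 1 → ψ x = 1)
    (hψnontriv : ∃ x : ℚ_[p], ‖x‖ ≤ (p : ℝ) ∧ ψ x ≠ 1) (a b : ℚ_[p]) :
    ∫ x in closedBall 0 ‖a‖, ψ (b * x) ∂μ =
      if ‖b * a‖ ≤ 1 then (μ.real (closedBall 0 ‖a‖) : ℂ) else 0 := by
  split_ifs with h
  · rw [setIntegral_congr_fun (g := fun _ ↦ (1 : ℂ)) isClosed_closedBall.measurableSet]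
    · simp
    · intro x hx
      refine hψtriv _ (le_trans ?_ h)
      rw [norm_mul, norm_mul]
      gcongr
      simpa using hx
  · obtain ⟨t, ht, ht1⟩ :=
      Padic.exists_norm_le_addChar_mul_ne_one hψnontriv (not_le.1 h)
    rw [← integral_indicator isClosed_closedBall.measurableSet]
    set F : ℚ_[p] → ℂ := (closedBall 0 ‖a‖).indicator fun x ↦ ψ (b * x) with hF
    have hmem (x : ℚ_[p]) : x + t ∈ closedBall 0 ‖a‖ ↔ x ∈ closedBall 0 ‖a‖ := by
      simp only [mem_closedBall_zero_iff]
      constructor <;> intro hx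
      · simpa using (Padic.nonarchimedean (x + t) (-t)).trans
          (max_le hx (by rwa [norm_neg]))
      · exact (Padic.nonarchimedean x t).trans (max_le hx ht)
    have hFt (x : ℚ_[p]) : F (x + t) = ψ (b * t) * F x := by
      classical
      simp only [hF, Set.indicator_apply, hmem]
      split_ifs
      · rw [mul_add, AddChar.map_add_eq_mul, mul_comm]
      · simp
    have hI := integral_add_right_eq_self (μ := μ) F t
    simp only [hFt, integral_const_mul] at hI
    by_contra hne
    exact ht1 (mul_right_cancel₀ hne (by rwa [one_mul]))

end PadicHaar

lemma IsLocallyConstant.exists_forall_dist_lt_eq {X Y : Type*} [PseudoMetricSpace X] [Zero Y]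
    {f : X → Y} (hf : IsLocallyConstant f) (hc : HasCompactSupport f) :
    ∃ δ > 0, ∀ x y, dist x y < δ → f x = f y := by
  obtain ⟨δ, hδ, h⟩ := lebesgue_number_lemma_of_metric (c := fun c : Y ↦ f ⁻¹' {c}) hc
    (fun c ↦ hf.isOpen_fiber c) (fun x _ ↦ Set.mem_iUnion.2 ⟨f x, rfl⟩)
  have key (x y : X) (hx : x ∈ tsupport f) (hxy : dist x y < δ) : f x = f y := by
    obtain ⟨c, hc⟩ := h x hx
    have h₁ : f x = c := hc (mem_ball_self hδ)
    have h₂ : f y = c := hc (by rwa [mem_ball'])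
    rw [h₁, h₂]
  refine ⟨δ, hδ, fun x y hxy ↦ ?_⟩
  by_cases hx : x ∈ tsupport f
  · exact key x y hx hxy
  by_cases hy : y ∈ tsupport f
  · exact (key y x hy (by rwa [dist_comm])).symm
  · rw [image_eq_zero_of_notMem_tsupport hx, image_eq_zero_of_notMem_tsupport hy]

section SympFourier

variable {p : ℕ} [Fact p.Prime] [MeasurableSpace ℚ_[p]] [BorelSpace ℚ_[p]]
  (μ : Measure ℚ_[p]) [μ.IsAddHaarMeasure] {ψ : AddChar ℚ_[p] ℂ}

lemma sympFourier_eq_mul_of_add_eq {f : ℚ_[p] × ℚ_[p] → ℂ} {h : ℚ_[p] × ℚ_[p]}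
    (hf : ∀ x, f (x + h) = f x) (y : ℚ_[p] × ℚ_[p]) :
    sympFourier p μ ψ f y = ψ (h.1 * y.2 - h.2 * y.1) * sympFourier p μ ψ f y := by
  have hI := integral_add_right_eq_self (μ := μ.prod μ)
    (fun x ↦ ψ (x.1 * y.2 - x.2 * y.1) * f x) h
  unfold sympFourier
  rw [← integral_const_mul]
  nth_rw 1 [← hI]
  congr 1
  ext x
  rw [hf, ← mul_assoc, ← AddChar.map_add_eq_mul]
  congr 2
  simp only [Prod.fst_add, Prod.snd_add]
  ring

lemma sympFourier_eq_zero_of_notMem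
    (hψnontriv : ∃ x : ℚ_[p], ‖x‖ ≤ (p : ℝ) ∧ ψ x ≠ 1)
    {f : ℚ_[p] × ℚ_[p] → ℂ} {a : ℚ_[p]} (ha : a ≠ 0)
    (hf : ∀ x h : ℚ_[p] × ℚ_[p], ‖h‖ ≤ ‖a‖ → f (x + h) = f x)
    {y : ℚ_[p] × ℚ_[p]} (hy : y ∉ closedBall (0 : ℚ_[p]) ‖a⁻¹‖ ×ˢ closedBall (0 : ℚ_[p]) ‖a⁻¹‖) :
    sympFourier p μ ψ f y = 0 := by
  have ha' : 0 < ‖a‖ := norm_pos_iff.2 ha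
  suffices ∃ h : ℚ_[p] × ℚ_[p], ‖h‖ ≤ ‖a‖ ∧ ψ (h.1 * y.2 - h.2 * y.1) ≠ 1 by
    obtain ⟨h, hh, h1⟩ := this
    by_contra hne
    refine h1 (mul_right_cancel₀ hne ?_)
    rw [one_mul, ← sympFourier_eq_mul_of_add_eq μ (fun x ↦ hf x h hh)]
  rw [Set.mem_prod, not_and_or] at hy
  simp only [mem_closedBall_zero_iff, not_le, norm_inv] at hy
  rcases hy with hy | hy
  · rw [inv_lt_iff_one_lt_mul₀ ha', ← norm_mul] at hy
    obtain ⟨t, ht, ht1⟩ := Padic.exists_norm_le_addChar_mul_ne_one hψnontriv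
      (a := a) (b := -y.1) (by simpa using hy)
    refine ⟨(0, t), by simpa using ht, ?_⟩
    convert ht1 using 2
    ring
  · rw [inv_lt_iff_one_lt_mul₀ ha', ← norm_mul] at hy
    obtain ⟨t, ht, ht1⟩ := Padic.exists_norm_le_addChar_mul_ne_one hψnontriv hy
    refine ⟨(t, 0), by simpa using ht, ?_⟩
    convert ht1 using 2
    ring

lemma setIntegral_closedBall_prod_addChar_symplectic
    (hψtriv : ∀ x : ℚ_[p], ‖x‖ ≤ 1 → ψ x = 1)
    (hψnontriv : ∃ x : ℚ_[p], ‖x‖ ≤ (p : ℝ) ∧ ψ x ≠ 1) {a : ℚ_[p]} (ha : a ≠ 0)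
    (x z : ℚ_[p] × ℚ_[p]) :
    ∫ y in closedBall (0 : ℚ_[p]) ‖a⁻¹‖ ×ˢ closedBall (0 : ℚ_[p]) ‖a⁻¹‖,
      ψ (y.1 * z.2 - y.2 * z.1) * ψ (x.1 * y.2 - x.2 * y.1) ∂(μ.prod μ) =
    (closedBall z ‖a‖).indicator (fun _ ↦ (μ.real (closedBall 0 ‖a⁻¹‖) : ℂ) ^ 2) x := by
  have hsplit (y : ℚ_[p] × ℚ_[p]) : ψ (y.1 * z.2 - y.2 * z.1) * ψ (x.1 * y.2 - x.2 * y.1) =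
      ψ ((z.2 - x.2) * y.1) * ψ ((x.1 - z.1) * y.2) := by
    rw [← AddChar.map_add_eq_mul, ← AddChar.map_add_eq_mul]
    congr 1
    ring
  have hiff (b : ℚ_[p]) : ‖b * a⁻¹‖ ≤ 1 ↔ ‖b‖ ≤ ‖a‖ := by
    rw [norm_mul, norm_inv, ← div_eq_mul_inv, div_le_one (norm_pos_iff.2 ha)]
  simp only [hsplit]
  rw [setIntegral_prod_mul (μ := μ) (ν := μ) (fun s ↦ ψ ((z.2 - x.2) * s))
      (fun s ↦ ψ ((x.1 - z.1) * s)),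
    Padic.setIntegral_closedBall_addChar_mul μ hψtriv hψnontriv,
    Padic.setIntegral_closedBall_addChar_mul μ hψtriv hψnontriv]
  classical
  simp only [hiff, Set.indicator_apply, mem_closedBall, dist_eq_norm, Prod.norm_def,
    Prod.fst_sub, Prod.snd_sub, max_le_iff, norm_sub_rev z.2 x.2]
  by_cases h₁ : ‖x.1 - z.1‖ ≤ ‖a‖ <;> by_cases h₂ : ‖x.2 - z.2‖ ≤ ‖a‖ <;> simp [h₁, h₂, sq]

end SympFourier

/-- the symplectic Fourier transform is an involution on locally constant
compactly supported functions: `Φ(Φ(f)) = f`. -/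
theorem sympFourier_involutive (p : ℕ) [Fact p.Prime]
    [MeasurableSpace ℚ_[p]] [BorelSpace ℚ_[p]]
    (μ : Measure ℚ_[p]) [μ.IsAddHaarMeasure]
    (hμ : μ {x : ℚ_[p] | ‖x‖ ≤ 1} = 1)
    (ψ : AddChar ℚ_[p] ℂ) (hψcont : Continuous ψ)
    (hψnorm : ∀ x : ℚ_[p], ‖ψ x‖ = 1)
    (hψtriv : ∀ x : ℚ_[p], ‖x‖ ≤ 1 → ψ x = 1)
    (hψnontriv : ∃ x : ℚ_[p], ‖x‖ ≤ (p : ℝ) ∧ ψ x ≠ 1)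
    (f : ℚ_[p] × ℚ_[p] → ℂ) (hf₁ : IsLocallyConstant f) (hf₂ : HasCompactSupport f) :
    sympFourier p μ ψ (sympFourier p μ ψ f) = f := by
  have hμ' : μ (closedBall 0 1) = 1 := by
    rw [← hμ]
    congr 1
    ext x
    simp
  obtain ⟨δ, hδ, hfδ⟩ := hf₁.exists_forall_dist_lt_eq hf₂
  obtain ⟨a, ha0, haδ⟩ := NormedField.exists_norm_lt ℚ_[p] hδ
  have ha : a ≠ 0 := norm_pos_iff.1 ha0
  have hinv (x h : ℚ_[p] × ℚ_[p]) (hh : ‖h‖ ≤ ‖a‖) : f (x + h) = f x :=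
    hfδ _ _ (by simpa [dist_eq_norm] using hh.trans_lt haδ)
  have hfint : Integrable f (μ.prod μ) := hf₁.continuous.integrable_of_hasCompactSupport hf₂
  set B : Set (ℚ_[p] × ℚ_[p]) := closedBall 0 ‖a⁻¹‖ ×ˢ closedBall 0 ‖a⁻¹‖ with hB
  have hBfin : (μ.prod μ) B < ⊤ :=
    ((isCompact_closedBall _ _).prod (isCompact_closedBall _ _)).measure_lt_top
  have : IsFiniteMeasure ((μ.prod μ).restrict B) := ⟨by simpa using hBfin⟩
  ext z
  have hintegrable : Integrable (Function.uncurry fun y x : ℚ_[p] × ℚ_[p] ↦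
      (ψ (y.1 * z.2 - y.2 * z.1) * ψ (x.1 * y.2 - x.2 * y.1)) * f x)
      (((μ.prod μ).restrict B).prod (μ.prod μ)) := by
    refine (hfint.comp_snd ((μ.prod μ).restrict B)).bdd_mul (c := 1) ?_ ?_
    · exact Continuous.aestronglyMeasurable (by fun_prop)
    · exact .of_forall fun w ↦ by simp [hψnorm]
  calc sympFourier p μ ψ (sympFourier p μ ψ f) z
      = ∫ y in B, ψ (y.1 * z.2 - y.2 * z.1) * sympFourier p μ ψ f y ∂(μ.prod μ) := by
        refine (setIntegral_eq_integral_of_forall_compl_eq_zero fun y hy ↦ ?_).symm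
        rw [sympFourier_eq_zero_of_notMem μ hψnontriv ha hinv hy, mul_zero]
    _ = ∫ y in B, ∫ x, (ψ (y.1 * z.2 - y.2 * z.1) * ψ (x.1 * y.2 - x.2 * y.1)) * f x
          ∂(μ.prod μ) ∂(μ.prod μ) := by
        simp only [sympFourier, ← integral_const_mul, mul_assoc]
    _ = ∫ x, (∫ y in B, ψ (y.1 * z.2 - y.2 * z.1) * ψ (x.1 * y.2 - x.2 * y.1) ∂(μ.prod μ)) * f x
          ∂(μ.prod μ) := by
        rw [integral_integral_swap hintegrable]
        simp only [integral_mul_const]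
    _ = ∫ x, (closedBall z ‖a‖).indicator
          (fun _ ↦ (μ.real (closedBall 0 ‖a⁻¹‖) : ℂ) ^ 2 * f z) x ∂(μ.prod μ) := by
        congr 1
        ext x
        rw [hB, setIntegral_closedBall_prod_addChar_symplectic μ hψtriv hψnontriv ha]
        by_cases hx : x ∈ closedBall z ‖a‖
        · rw [Set.indicator_of_mem hx, Set.indicator_of_mem hx,
            hfδ x z ((mem_closedBall.1 hx).trans_lt haδ)]
        · rw [Set.indicator_of_notMem hx, Set.indicator_of_notMem hx, zero_mul]
    _ = (μ.real (closedBall 0 ‖a‖) * μ.real (closedBall 0 ‖a⁻¹‖) : ℂ) ^ 2 * f z := by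
        rw [integral_indicator_const _ isClosed_closedBall.measurableSet,
          ← Prod.mk.eta (p := z), ← closedBall_prod_same, measureReal_prod_prod,
          measureReal_def, measureReal_def, Measure.addHaar_closedBall_center μ z.1,
          Measure.addHaar_closedBall_center μ z.2, ← measureReal_def, Complex.real_smul]
        push_cast
        ring
    _ = f z := by
        rw [← Complex.ofReal_mul, measureReal_def, measureReal_def, ← ENNReal.toReal_mul,
          Padic.measure_closedBall_mul_measure_closedBall_inv μ hμ' ha]
        simp
end

section
/- The family (K(γ))_{γ∈Γ} is summable with total sum Σ_{γ∈Γ} K(γ) = (1 − q^{-1})^{−|ι|}, where |ι| is the cardinality of ι. -/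
open scoped BigOperators

/-- The `q`-analog of Kostant's partition function:
`K(γ) = Σ_{m : ι → ℕ, Σ_i m(i)·s(i) = γ} q^{−Σ_i m(i)}` (a `tsum`, which for each `γ`
has finitely many nonzero terms by the positivity hypothesis on `f ∘ s`). -/
noncomputable def kostantQ {Γ : Type*} [AddCommGroup Γ] {ι : Type*} [Fintype ι]
    (s : ι → Γ) (q : ℝ) (γ : Γ) : ℝ :=
  ∑' m : {m : ι → ℕ // ∑ i, m i • s i = γ}, q ^ (-(∑ i, (m.1 i : ℤ)))

theorem hasSum_prod_fin_of_nonneg {β : Type*} {n : ℕ} {g : Fin n → β → ℝ} {a : Fin n → ℝ}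
    (hg : ∀ i b, 0 ≤ g i b) (h : ∀ i, HasSum (g i) (a i)) :
    HasSum (fun m : Fin n → β => ∏ i, g i (m i)) (∏ i, a i) := by
  induction n with
  | zero => simp
  | succ n ih =>
    have ht := ih (fun i => hg i.succ) (fun i => h i.succ)
    have hs := (h 0).summable.mul_of_nonneg ht.summable (hg 0)
      (fun m => Finset.prod_nonneg fun i _ => hg i.succ (m i))
    rw [← (Fin.consEquiv fun _ : Fin (n + 1) => β).hasSum_iff, Fin.prod_univ_succ]
    refine ((h 0).mul ht hs).congr_fun fun p => ?_
    simp [Fin.prod_univ_succ, Fin.consEquiv]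

/-- A finite product of sums of nonnegative families expands as a sum over choice functions. -/
theorem hasSum_prod_of_nonneg {ι β : Type*} [Fintype ι] {g : ι → β → ℝ} {a : ι → ℝ}
    (hg : ∀ i b, 0 ≤ g i b) (h : ∀ i, HasSum (g i) (a i)) :
    HasSum (fun m : ι → β => ∏ i, g i (m i)) (∏ i, a i) := by
  let e := Fintype.equivFin ι
  have key := hasSum_prod_fin_of_nonneg (fun i => hg (e.symm i)) (fun i => h (e.symm i))
  rw [e.symm.prod_comp a, ← (e.arrowCongr (Equiv.refl β)).hasSum_iff] at key
  convert key using 2 with m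
  simp [← e.symm.prod_comp fun i => g i (m i)]

/-- the family `(K(γ))_{γ ∈ Γ}` is summable, with total sum
`Σ_γ K(γ) = (1 − q⁻¹)^{−|ι|}`. -/
theorem kostantQ_summable_tsum {Γ : Type*} [AddCommGroup Γ] {ι : Type*} [Fintype ι]
    (s : ι → Γ) (f : Γ →+ ℝ) (hf : ∀ i, 0 < f (s i)) (q : ℝ) (hq : 1 < q) :
    Summable (kostantQ s q) ∧
      ∑' γ : Γ, kostantQ s q γ = (1 - q⁻¹) ^ (-(Fintype.card ι : ℤ)) := by
  have hq0 : 0 < q := one_pos.trans hq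
  have hgeom : HasSum (fun n : ℕ => q⁻¹ ^ n) (1 - q⁻¹)⁻¹ :=
    hasSum_geometric_of_lt_one (inv_nonneg.2 hq0.le) (inv_lt_one_of_one_lt₀ hq)
  have htotal : HasSum (fun m : ι → ℕ => q ^ (-(∑ i, (m i : ℤ))))
      ((1 - q⁻¹) ^ (-(Fintype.card ι : ℤ))) := by
    convert hasSum_prod_of_nonneg (ι := ι) (fun _ n => pow_nonneg (inv_nonneg.2 hq0.le) n)
      (fun _ => hgeom) using 1
    · ext m
      rw [Finset.prod_pow_eq_pow_sum, ← Nat.cast_sum, zpow_neg, zpow_natCast, inv_pow]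
    · simp
  have hK : HasSum (kostantQ s q) ((1 - q⁻¹) ^ (-(Fintype.card ι : ℤ))) :=
    htotal.tsum_fiberwise fun m => ∑ i, m i • s i
  exact ⟨hK.summable, hK.tsum_eq⟩
end

section
/- The family (K(γ)²)_{γ∈Γ} is summable, i.e. Σ_{γ∈Γ} K(γ)² converges. -/
open scoped BigOperators

/-- Geometric families over `ι → ℕ`, with `ι` finite, are summable. -/
theorem summable_prod_pow_of_lt_one {ι : Type*} [Fintype ι] {r : ℝ} (hr₀ : 0 ≤ r) (hr₁ : r < 1) :
    Summable (fun m : ι → ℕ => ∏ i, r ^ m i) := by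
  classical
  refine summable_of_sum_le (c := ∏ _i : ι, ∑' n : ℕ, r ^ n)
    (fun m => Finset.prod_nonneg fun i _ => pow_nonneg hr₀ _) fun u => ?_
  have hu : u ⊆ Fintype.piFinset fun i => u.image fun m => m i := fun m hm =>
    Fintype.mem_piFinset.2 fun i => Finset.mem_image_of_mem (fun m : ι → ℕ => m i) hm
  calc ∑ m ∈ u, ∏ i, r ^ m i
      ≤ ∑ m ∈ Fintype.piFinset fun i => u.image fun m => m i, ∏ i, r ^ m i :=
        Finset.sum_le_sum_of_subset_of_nonneg hu fun m _ _ =>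
          Finset.prod_nonneg fun i _ => pow_nonneg hr₀ _
    _ = ∏ i, ∑ n ∈ u.image fun m => m i, r ^ n :=
        (Finset.prod_univ_sum _ fun _ n => r ^ n).symm
    _ ≤ ∏ _i : ι, ∑' n : ℕ, r ^ n :=
        Finset.prod_le_prod (fun i _ => Finset.sum_nonneg fun n _ => pow_nonneg hr₀ n) fun i _ =>
          (summable_geometric_of_lt_one hr₀ hr₁).sum_le_tsum _ fun n _ => pow_nonneg hr₀ n

/-- Kostant's `q`-partition function is summable for `q > 1`. -/
theorem summable_kostantQ {Γ : Type*} [AddCommGroup Γ] {ι : Type*} [Fintype ι]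
    (s : ι → Γ) {q : ℝ} (hq : 1 < q) : Summable (kostantQ s q) := by
  have h : Summable (fun m : ι → ℕ => q ^ (-(∑ i, (m i : ℤ)))) := by
    refine (summable_prod_pow_of_lt_one (ι := ι) (inv_nonneg.2 (zero_le_one.trans hq.le))
      (inv_lt_one_of_one_lt₀ hq)).congr fun m => ?_
    rw [Finset.prod_pow_eq_pow_sum, zpow_neg, ← Nat.cast_sum, zpow_natCast, inv_pow]
  exact ((Equiv.sigmaFiberEquiv fun m : ι → ℕ => ∑ i, m i • s i).summable_iff.2 h).sigma

theorem kostantQ_nonneg {Γ : Type*} [AddCommGroup Γ] {ι : Type*} [Fintype ι]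
    (s : ι → Γ) {q : ℝ} (hq : 0 ≤ q) (γ : Γ) : 0 ≤ kostantQ s q γ :=
  tsum_nonneg fun _ => zpow_nonneg hq _

/-- the family `(K(γ)²)_{γ ∈ Γ}` is summable. -/
theorem kostantQ_sq_summable {Γ : Type*} [AddCommGroup Γ] {ι : Type*} [Fintype ι]
    (s : ι → Γ) (f : Γ →+ ℝ) (hf : ∀ i, 0 < f (s i)) (q : ℝ) (hq : 1 < q) :
    Summable (fun γ : Γ => (kostantQ s q γ) ^ 2) := by
  have hK := summable_kostantQ s hq
  refine hK.of_norm_bounded_eventually ?_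
  filter_upwards [hK.tendsto_cofinite_zero.eventually_le_const one_pos] with γ hγ
  have h₀ := kostantQ_nonneg s (zero_le_one.trans hq.le) γ
  rw [Real.norm_of_nonneg (sq_nonneg _)]
  exact pow_le_of_le_one h₀ hγ two_ne_zero
end
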